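/- Let k be a commutative ring and let T be a skeletally small k-linear triangulated category with split idempotents such that for all objects X, Y of T the k-module Hom_T(X,Y) has finite length, and such that for all objects X, Y there is an integer n = n_{XY} with Hom_T(X,Y[j]) = 0 for all j < n. If M and N are objects of T with M ⪯_Δ N and N ⪯_Δ M, then M ≅ N; consequently ⪯_Δ is a partial order on the set of isomorphism classes of objects of T. -/

import Mathlib

open CategoryTheory Limits Pretriangulated

universe v u w

section DeltaRelation

variable (T : Type u) [Category.{v} T] [Preadditive T] [HasZeroObject T]
  [HasShift T ℤ] [∀ n : ℤ, (shiftFunctor T n).Additive] [Pretriangulated T]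

/-- One step of triangle degeneration: `X ≤_Δ Y` in one step when there are an object `Z`
and a distinguished triangle `Z → Z ⊞ X → Y → Z⟦1⟧`. -/
def deltaStep (X Y : T) : Prop :=
  ∃ (Z : T) (v : Z ⟶ Z) (u : Z ⟶ X) (w : Z ⊞ X ⟶ Y) (d : Y ⟶ Z⟦(1:ℤ)⟧),
    Triangle.mk (biprod.lift v u) w d ∈ distTriang T

/-- `⪯_Δ` : the smallest transitive relation containing `deltaStep`. -/
def deltaLE (X Y : T) : Prop :=
  Relation.TransGen (deltaStep T) X Y

end DeltaRelation

section FittingDichotomy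

variable (k : Type*) {R : Type*} [CommRing k] [Ring R] [Algebra k R]
  [IsArtinian k R] [IsNoetherian k R]

include k

/-- In an algebra of finite length without nontrivial idempotents, `g` or `1 - g` is a unit. -/
theorem isUnit_or_isUnit_one_sub_of_idempotents_trivial
    (hidem : ∀ e : R, IsIdempotentElem e → e = 0 ∨ e = 1) (g : R) :
    IsUnit g ∨ IsUnit (1 - g) := by
  obtain ⟨n, hn, hn1⟩ :=
    ((LinearMap.mulLeft k g).eventually_isCompl_ker_pow_range_pow.and
      (Filter.eventually_ge_atTop 1)).exists
  rw [LinearMap.pow_mulLeft] at hn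
  obtain ⟨e, he, y, ⟨w, rfl⟩, hsum⟩ := Submodule.mem_sup.mp
    (hn.sup_eq_top ▸ Submodule.mem_top : (1 : R) ∈ _)
  simp only [LinearMap.mem_ker, LinearMap.mulLeft_apply] at he hsum
  have he2 : IsIdempotentElem e := by
    have hmem : e - e * e ∈ LinearMap.ker (LinearMap.mulLeft k (g ^ n)) ⊓
        LinearMap.range (LinearMap.mulLeft k (g ^ n)) := by
      refine ⟨?_, w * e, ?_⟩
      · simp [mul_sub, he, ← mul_assoc]
      · rw [LinearMap.mulLeft_apply, ← mul_assoc, eq_sub_of_add_eq' hsum, sub_mul, one_mul]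
    rw [hn.inf_eq_bot, Submodule.mem_bot, sub_eq_zero] at hmem
    exact hmem.symm
  rcases hidem e he2 with rfl | rfl
  · left
    obtain ⟨m, rfl⟩ : ∃ m, n = m + 1 := ⟨n - 1, by lia⟩
    rw [zero_add, pow_succ', mul_assoc] at hsum
    have : IsNoetherianRing R := isNoetherian_of_tower k inferInstance
    exact IsUnit.of_mul_eq_one _ hsum
  · right
    rw [mul_one] at he
    exact IsNilpotent.isUnit_one_sub ⟨n, he⟩

end FittingDichotomy

section Cancellation

variable (k : Type w) [CommRing k] {C : Type u} [Category.{v} C] [Preadditive C]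
  [HasBinaryBiproducts C] [Linear k C]

include k in
theorem nonempty_iso_of_biprod_iso_of_idempotents_trivial {Z : C}
    (hZ : IsFiniteLength k (Z ⟶ Z))
    (hidem : ∀ e : Z ⟶ Z, e ≫ e = e → e = 0 ∨ e = 𝟙 Z) {M N : C} (f : Z ⊞ M ≅ Z ⊞ N) :
    Nonempty (M ≅ N) := by
  have hZ' := isFiniteLength_iff_isNoetherian_isArtinian.mp hZ
  have : IsNoetherian k (End Z) := hZ'.1
  have : IsArtinian k (End Z) := hZ'.2
  let a : Z ⟶ Z := biprod.inl ≫ f.hom ≫ biprod.fst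
  let a' : Z ⟶ Z := biprod.inl ≫ f.inv ≫ biprod.fst
  let c : Z ⟶ M := biprod.inl ≫ f.inv ≫ biprod.snd
  let b : M ⟶ Z := biprod.inr ≫ f.hom ≫ biprod.fst
  have hsum : a' ≫ a + c ≫ b = 𝟙 Z := by
    calc a' ≫ a + c ≫ b
        = biprod.inl ≫ f.inv ≫ (biprod.fst ≫ biprod.inl + biprod.snd ≫ biprod.inr) ≫
            f.hom ≫ biprod.fst := by simp only [a, a', b, c, Preadditive.comp_add,
              Preadditive.add_comp, Category.assoc]
      _ = 𝟙 Z := by simp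
  suffices ∃ r : Z ⟶ M, IsIso (a + r ≫ b) by
    obtain ⟨r, hr⟩ := this
    have : IsIso (biprod.inl ≫ (Biprod.unipotentUpper r ≪≫ f).hom ≫ biprod.fst) := by
      convert hr using 1
      have h := Biprod.inl_ofComponents (𝟙 Z) r 0 (𝟙 M)
      simp [a, b, reassoc_of% h]
    exact ⟨Biprod.isoElim (Biprod.unipotentUpper r ≪≫ f)⟩
  rcases isUnit_or_isUnit_one_sub_of_idempotents_trivial k (R := End Z)
    (fun e he ↦ hidem e he) (End.of a * (End.of a' - 1)) with h | h
  · obtain ⟨y, hy⟩ := h.exists_right_inv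
    rw [mul_assoc] at hy
    have : IsNoetherianRing (End Z) := isNoetherian_of_tower k inferInstance
    refine ⟨0, ?_⟩
    rw [zero_comp, add_zero]
    exact (isUnit_iff_isIso a).mp (IsUnit.of_mul_eq_one _ hy)
  · refine ⟨c, ?_⟩
    convert (isUnit_iff_isIso (1 - End.of a * (End.of a' - 1))).mp h using 1
    have hcb : c ≫ b = 𝟙 Z - a' ≫ a := eq_sub_of_add_eq' hsum
    have hmul : End.of a * (End.of a' - 1) = (a' - 𝟙 Z) ≫ a := rfl
    have hone : (1 : End Z) = 𝟙 Z := rfl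
    rw [hcb, hmul, hone, Preadditive.sub_comp, Category.id_comp]
    abel

/-- Cancellation of a direct summand in an idempotent complete category whose Hom-modules have
finite length. -/
theorem nonempty_iso_of_biprod_iso [IsIdempotentComplete C]
    (hfl : ∀ X Y : C, IsFiniteLength k (X ⟶ Y)) (Z : C) {M N : C} (f : Z ⊞ M ≅ Z ⊞ N) :
    Nonempty (M ≅ N) := by
  induction h : Module.length k (Z ⟶ Z) using WellFoundedLT.induction generalizing Z M N with
  | ind l ih =>
  subst h
  by_cases hidem : ∀ e : Z ⟶ Z, e ≫ e = e → e = 0 ∨ e = 𝟙 Z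
  · exact nonempty_iso_of_biprod_iso_of_idempotents_trivial k (hfl Z Z) hidem f
  push Not at hidem
  obtain ⟨e, he, he0, he1⟩ := hidem
  have hlt : ∀ (Y : C) (i : Y ⟶ Z) (p : Z ⟶ Y), i ≫ p = 𝟙 Y → p ≫ i ≠ 𝟙 Z →
      Module.length k (Y ⟶ Y) < Module.length k (Z ⟶ Z) := by
    intro Y i p hip hpi
    let φ : (Y ⟶ Y) →ₗ[k] (Z ⟶ Z) := Linear.leftComp k Z p ∘ₗ Linear.rightComp k Y i
    have hφ : ∀ x, φ x = p ≫ x ≫ i := fun _ ↦ rfl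
    have hinj : Function.Injective φ := fun x y hxy ↦ by
      have := congrArg (fun t ↦ i ≫ t ≫ p) hxy
      simpa [hφ, hip, reassoc_of% hip] using this
    have hZ' := isFiniteLength_iff_isNoetherian_isArtinian.mp (hfl Z Z)
    have := hZ'.1
    have := hZ'.2
    rw [(LinearEquiv.ofInjective φ hinj).length_eq]
    refine Submodule.length_lt fun htop ↦ hpi ?_
    obtain ⟨x, hx⟩ := LinearMap.range_eq_top.mp htop (𝟙 Z)
    rw [hφ] at hx
    have h2 : p ≫ i ≫ p ≫ x ≫ i = p ≫ i ≫ 𝟙 Z := by rw [hx]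
    rw [reassoc_of% hip, hx] at h2
    simpa using h2.symm
  obtain ⟨Y, i, p, hip, hpi⟩ := IsIdempotentComplete.idempotents_split Z e he
  obtain ⟨Y', i', p', hip', hpi'⟩ := IsIdempotentComplete.idempotents_split Z (𝟙 Z - e)
    (Idempotents.idem_of_id_sub_idem e he)
  have hep : e ≫ p = p := by rw [← hpi, Category.assoc, hip, Category.comp_id]
  have hie : i ≫ e = i := by rw [← hpi, reassoc_of% hip]
  have hep' : e ≫ p' = 0 := by
    have : (𝟙 Z - e) ≫ p' = p' := by rw [← hpi', Category.assoc, hip', Category.comp_id]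
    simpa using this
  have hie' : i' ≫ e = 0 := by
    have : i' ≫ (𝟙 Z - e) = i' := by rw [← hpi', reassoc_of% hip']
    simpa using this
  have hip0 : i ≫ p' = 0 := by rw [← hie, Category.assoc, hep', comp_zero]
  have hip0' : i' ≫ p = 0 := by rw [← hep, reassoc_of% hie', zero_comp]
  let s : Z ≅ Y ⊞ Y' :=
    { hom := biprod.lift p p'
      inv := biprod.desc i i'
      hom_inv_id := by simp [hpi, hpi']
      inv_hom_id := by ext <;> simp [hip, hip', hip0, hip0'] }
  let t (M : C) : Z ⊞ M ≅ Y ⊞ (Y' ⊞ M) :=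
    biprod.mapIso s (Iso.refl M) ≪≫ biprod.associator Y Y' M
  obtain ⟨g⟩ := ih _ (hlt Y i p hip (hpi ▸ he1)) Y ((t M).symm ≪≫ f ≪≫ t N) rfl
  refine ih _ (hlt Y' i' p' hip' ?_) Y' g rfl
  rw [hpi']
  simpa using he0

end Cancellation

section Length

variable (k : Type w) [CommRing k]

theorem Module.length_eq_length_range_add_length_range {A B D : Type*} [AddCommGroup A]
    [AddCommGroup B] [AddCommGroup D] [Module k A] [Module k B] [Module k D]
    {f : A →ₗ[k] B} {g : B →ₗ[k] D} (h : Function.Exact f g) :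
    Module.length k B = Module.length k (LinearMap.range f) +
      Module.length k (LinearMap.range g) := by
  refine Module.length_eq_add_of_exact (LinearMap.range f).subtype g.rangeRestrict
    (Submodule.subtype_injective _) g.surjective_rangeRestrict ?_
  rw [LinearMap.exact_iff] at h ⊢
  rw [LinearMap.ker_rangeRestrict, h, Submodule.range_subtype]

theorem CategoryTheory.Functor.length_obj_biprod {C : Type u} [Category.{v} C] [Preadditive C]
    [HasBinaryBiproducts C] (F : C ⥤ ModuleCat.{v} k) [F.Additive] (X Y : C) :
    Module.length k (F.obj (X ⊞ Y)) = Module.length k (F.obj X) + Module.length k (F.obj Y) := by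
  have hid (A B : C) (f : A ⟶ B) (g : B ⟶ A) (h : f ≫ g = 𝟙 A) (x : F.obj A) :
      F.map g (F.map f x) = x := by
    rw [← ConcreteCategory.comp_apply, ← F.map_comp, h, F.map_id, ConcreteCategory.id_apply]
  refine Module.length_eq_add_of_exact (F.map biprod.inl).hom (F.map biprod.snd).hom
    (Function.LeftInverse.injective (hid _ _ _ biprod.fst biprod.inl_fst))
    (Function.RightInverse.surjective (hid _ _ biprod.inr _ biprod.inr_snd)) ?_
  have := (((ShortComplex.Splitting.mk biprod.fst biprod.inr (by simp) (by simp)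
    (by simp [biprod.total]) : (ShortComplex.mk (biprod.inl : X ⟶ X ⊞ Y) biprod.snd
      (by simp)).Splitting).map F).exact)
  exact (ShortComplex.ShortExact.moduleCat_exact_iff_function_exact _).mp this

end Length

theorem ENat.eq_add_add_of_exact_ranks {z x y b p q s t : ℕ∞} (hz : z ≠ ⊤) (hb : b = z + x)
    (h₁ : z = p + s) (h₂ : b = s + t) (h₃ : y = t + q) : y = x + (q + p) := by
  have hs : s ≠ ⊤ := ne_top_of_le_ne_top hz (h₁ ▸ le_add_self)
  have : s + (p + x) = s + t := by rw [← h₂, hb, h₁]; ring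
  rw [h₃, ← WithTop.add_left_cancel hs this]
  ring

theorem eventually_sum_eq {c m r : ℕ → ℕ} (h : ∀ i, c i = m i + (r i + r (i + 1)))
    (hr : ∀ᶠ i in Filter.atTop, c i = 0) :
    ∀ᶠ l in Filter.atTop, ∑ i ∈ Finset.range l, (-1 : ℤ) ^ i * c i =
      ∑ i ∈ Finset.range l, (-1 : ℤ) ^ i * m i + r 0 := by
  have key : ∀ l, ∑ i ∈ Finset.range l, (-1 : ℤ) ^ i * c i =
      ∑ i ∈ Finset.range l, (-1 : ℤ) ^ i * m i + r 0 - (-1) ^ l * r l := by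
    intro l
    induction l with
    | zero => simp
    | succ l ih =>
      rw [Finset.sum_range_succ, Finset.sum_range_succ, ih, h]
      push_cast
      ring
  filter_upwards [hr] with l hl
  have : r l = 0 := by have := h l; lia
  rw [key, this]
  simp

section Triangulated

variable (k : Type w) [CommRing k]

/-- The length of the image of the connecting map of a triangle in degree `n`. -/
noncomputable def connectingRank {T : Type u} [Category.{v} T] [Preadditive T] [HasShift T ℤ]
    (F : T ⥤ ModuleCat.{v} k) [F.ShiftSequence ℤ] (S : Triangle T) (n : ℤ) : ℕ∞ :=
  Module.length k (LinearMap.range (F.homologySequenceδ S n (n + 1) rfl).hom)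

/-- The alternating sum of the lengths of the values of `F` in the `l` degrees
`0, -1, …, -l + 1`. -/
noncomputable def truncatedEuler {T : Type u} [Category.{v} T] [HasShift T ℤ]
    (F : T ⥤ ModuleCat.{v} k) [F.ShiftSequence ℤ] (l : ℕ) (X : T) : ℤ :=
  ∑ i ∈ Finset.range l, (-1) ^ i * ((Module.length k ((F.shift (-i : ℤ)).obj X)).toNat : ℤ)

theorem connectingRank_ne_top {T : Type u} [Category.{v} T] [Preadditive T] [HasShift T ℤ]
    (F : T ⥤ ModuleCat.{v} k) [F.ShiftSequence ℤ]
    (hF : ∀ (n : ℤ) (X : T), Module.length k ((F.shift n).obj X) ≠ ⊤) (S : Triangle T) (n : ℤ) :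
    connectingRank k F S n ≠ ⊤ :=
  ne_top_of_le_ne_top (hF n S.obj₃)
    (Module.length_le_of_surjective _ (LinearMap.surjective_rangeRestrict _))

variable {T : Type u} [Category.{v} T] [Preadditive T] [HasZeroObject T]
  [HasShift T ℤ] [∀ n : ℤ, (shiftFunctor T n).Additive] [Pretriangulated T]

instance [Linear k T] (U : Tᵒᵖ) : ((linearCoyoneda k T).obj U).IsHomological where
  exact S hS := by
    rw [ShortComplex.moduleCat_exact_iff]
    intro (x₂ : U.unop ⟶ S.obj₂) (hx₂ : x₂ ≫ S.mor₂ = 0)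
    obtain ⟨x₁, hx₁⟩ := S.coyoneda_exact₂ hS x₂ hx₂
    exact ⟨x₁, hx₁.symm⟩

section HomologicalFunctor

variable (F : T ⥤ ModuleCat.{v} k) [F.IsHomological] [F.ShiftSequence ℤ]

theorem length_shift_obj_eq_of_distinguished
    (hF : ∀ (n : ℤ) (X : T), Module.length k ((F.shift n).obj X) ≠ ⊤) {X Y Z : T} {j : Z ⟶ Z ⊞ X}
    {w : Z ⊞ X ⟶ Y} {d : Y ⟶ Z⟦(1 : ℤ)⟧} (hT : Triangle.mk j w d ∈ distTriang T) (n : ℤ) :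
    Module.length k ((F.shift (n + 1)).obj Y) = Module.length k ((F.shift (n + 1)).obj X) +
      (connectingRank k F (.mk j w d) (n + 1) + connectingRank k F (.mk j w d) n) := by
  have : (F.shift (n + 1)).Additive := Functor.additive_of_iso (F.isoShift (n + 1))
  exact ENat.eq_add_add_of_exact_ranks (hF _ Z) ((F.shift (n + 1)).length_obj_biprod k Z X)
    (Module.length_eq_length_range_add_length_range k
      ((ShortComplex.ShortExact.moduleCat_exact_iff_function_exact _).mp
        (F.homologySequence_exact₁ _ hT n _ rfl)))
    (Module.length_eq_length_range_add_length_range k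
      ((ShortComplex.ShortExact.moduleCat_exact_iff_function_exact _).mp
        (F.homologySequence_exact₂ _ hT _)))
    (Module.length_eq_length_range_add_length_range k
      ((ShortComplex.ShortExact.moduleCat_exact_iff_function_exact _).mp
        (F.homologySequence_exact₃ _ hT _ _ rfl)))

theorem eventually_truncatedEuler_eq
    (hF : ∀ (n : ℤ) (X : T), Module.length k ((F.shift n).obj X) ≠ ⊤)
    (hF0 : ∀ X : T, ∀ᶠ i : ℕ in Filter.atTop, Module.length k ((F.shift (-i : ℤ)).obj X) = 0)
    {X Y Z : T} {j : Z ⟶ Z ⊞ X}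
    {w : Z ⊞ X ⟶ Y} {d : Y ⟶ Z⟦(1 : ℤ)⟧} (hT : Triangle.mk j w d ∈ distTriang T) :
    ∀ᶠ l in Filter.atTop, truncatedEuler k F l Y =
      truncatedEuler k F l X + (connectingRank k F (.mk j w d) 0).toNat := by
  refine eventually_sum_eq (r := fun i ↦ (connectingRank k F (.mk j w d) (-i : ℤ)).toNat)
    (fun i ↦ ?_) ((hF0 Y).mono fun i hi ↦ by rw [hi]; rfl)
  have h := length_shift_obj_eq_of_distinguished k F hF hT (-(i + 1 : ℕ) : ℤ)
  have hi : (-(i + 1 : ℕ) : ℤ) + 1 = -i := by push_cast; ring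
  rw [hi] at h
  have hr := connectingRank_ne_top k F hF (.mk j w d)
  have hr' (a b : ℤ) : connectingRank k F (.mk j w d) a + connectingRank k F (.mk j w d) b ≠ ⊤ :=
    WithTop.add_ne_top.mpr ⟨hr a, hr b⟩
  rw [h, ENat.toNat_add (hF _ _) (hr' _ _), ENat.toNat_add (hr _) (hr _)]

end HomologicalFunctor

attribute [local instance] Functor.ShiftSequence.tautological

theorem nonempty_biprod_iso_of_connectingRank_eq_zero [Linear k T] {X Y Z : T} {j : Z ⟶ Z ⊞ X}
    {w : Z ⊞ X ⟶ Y} {d : Y ⟶ Z⟦(1 : ℤ)⟧} (hT : Triangle.mk j w d ∈ distTriang T)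
    (h0 : connectingRank k ((linearCoyoneda k T).obj (.op (Y⟦(0 : ℤ)⟧))) (.mk j w d) 0 = 0) :
    Nonempty (Z ⊞ X ≅ Z ⊞ Y) := by
  let F := (linearCoyoneda k T).obj (.op (Y⟦(0 : ℤ)⟧))
  have hδ : F.homologySequenceδ (.mk j w d) 0 (0 + 1) rfl = 0 := by
    rw [connectingRank, Module.length_eq_zero_iff, Submodule.subsingleton_iff_eq_bot,
      LinearMap.range_eq_bot] at h0
    exact ModuleCat.hom_ext h0
  have hepi := (F.homologySequence_epi_shift_map_mor₂_iff _ hT 0 _ rfl).mpr hδ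
  rw [ModuleCat.epi_iff_surjective] at hepi
  obtain ⟨(s : Y⟦(0 : ℤ)⟧ ⟶ (Z ⊞ X)⟦(0 : ℤ)⟧), (hs : s ≫ w⟦(0 : ℤ)⟧' = 𝟙 _)⟩ :=
    hepi (𝟙 (Y⟦(0 : ℤ)⟧))
  have : IsSplitEpi (w⟦(0 : ℤ)⟧') := ⟨⟨⟨s, hs⟩⟩⟩
  have : Epi w := (shiftFunctor T (0 : ℤ)).epi_of_epi_map inferInstance
  obtain ⟨e, -⟩ := exists_iso_binaryBiproduct_of_distTriang _ hT
    (Triangle.mor₃_eq_zero_of_epi₂ _ hT this)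
  exact ⟨e⟩

/-- `X` precedes `Y` when, for all `U`, the truncated alternating sums of the lengths of
`U ⟶ X⟦-i⟧` are eventually bounded by those of `U ⟶ Y⟦-i⟧`. -/
def eulerLE (T : Type u) [Category.{v} T] [Preadditive T] [HasShift T ℤ] [Linear k T]
    (X Y : T) : Prop :=
  ∀ U : Tᵒᵖ, ∀ᶠ l in Filter.atTop, truncatedEuler k ((linearCoyoneda k T).obj U) l X ≤
    truncatedEuler k ((linearCoyoneda k T).obj U) l Y

theorem eulerLE.trans {T : Type u} [Category.{v} T] [Preadditive T] [HasShift T ℤ] [Linear k T]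
    {X Y Z : T} (h : eulerLE k T X Y) (h' : eulerLE k T Y Z) :
    eulerLE k T X Z := fun U ↦ by
  filter_upwards [h U, h' U] with l hl hl' using hl.trans hl'

section FiniteLength

variable [Linear k T] (hfl : ∀ X Y : T, IsFiniteLength k (X ⟶ Y))
  (hvanish : ∀ X Y : T, ∃ n : ℤ, ∀ j < n, ∀ f : X ⟶ Y⟦j⟧, f = 0)

include hfl hvanish

theorem eventually_truncatedEuler_linearCoyoneda_eq (U : Tᵒᵖ) {X Y Z : T} {j : Z ⟶ Z ⊞ X}
    {w : Z ⊞ X ⟶ Y} {d : Y ⟶ Z⟦(1 : ℤ)⟧} (hT : Triangle.mk j w d ∈ distTriang T) :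
    ∀ᶠ l in Filter.atTop, truncatedEuler k ((linearCoyoneda k T).obj U) l Y =
      truncatedEuler k ((linearCoyoneda k T).obj U) l X +
        (connectingRank k ((linearCoyoneda k T).obj U) (.mk j w d) 0).toNat := by
  refine eventually_truncatedEuler_eq k _ (fun n X ↦ Module.length_ne_top_iff.mpr (hfl _ _))
    (fun X ↦ ?_) hT
  obtain ⟨n, hn⟩ := hvanish U.unop X
  filter_upwards [Filter.eventually_gt_atTop (-n).toNat] with i hi
  rw [Module.length_eq_zero_iff]
  exact subsingleton_of_forall_eq (0 : U.unop ⟶ X⟦(-i : ℤ)⟧) (hn _ (by lia))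

theorem eulerLE_of_deltaStep {X Y : T} (h : deltaStep T X Y) : eulerLE k T X Y := fun U ↦ by
  obtain ⟨Z, v, u, w, d, hT⟩ := h
  filter_upwards [eventually_truncatedEuler_linearCoyoneda_eq k hfl hvanish U hT] with l hl
  lia

theorem eulerLE_of_deltaLE {X Y : T} (h : deltaLE T X Y) : eulerLE k T X Y := by
  induction h with
  | single h => exact eulerLE_of_deltaStep k hfl hvanish h
  | tail _ h ih => exact ih.trans k (eulerLE_of_deltaStep k hfl hvanish h)

variable [IsIdempotentComplete T]

theorem nonempty_iso_of_deltaStep {X Y : T} (h : deltaStep T X Y) (hYX : eulerLE k T Y X) :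
    Nonempty (X ≅ Y) := by
  obtain ⟨Z, v, u, w, d, hT⟩ := h
  let U : Tᵒᵖ := .op (Y⟦(0 : ℤ)⟧)
  obtain ⟨l, hl, hl'⟩ := ((eventually_truncatedEuler_linearCoyoneda_eq k hfl hvanish U hT).and
    (hYX U)).exists
  have h0 : (connectingRank k ((linearCoyoneda k T).obj U) (.mk (biprod.lift v u) w d) 0).toNat
      = 0 := by lia
  obtain ⟨f⟩ := nonempty_biprod_iso_of_connectingRank_eq_zero k hT
    ((ENat.toNat_eq_zero.mp h0).resolve_right
      (connectingRank_ne_top k _ (fun n X ↦ Module.length_ne_top_iff.mpr (hfl _ _)) _ _))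
  exact nonempty_iso_of_biprod_iso k hfl Z f

theorem nonempty_iso_of_deltaLE {X Y : T} (h : deltaLE T X Y) (hYX : eulerLE k T Y X) :
    Nonempty (X ≅ Y) := by
  induction h with
  | single h => exact nonempty_iso_of_deltaStep k hfl hvanish h hYX
  | tail hXY h ih =>
    obtain ⟨f⟩ := ih ((eulerLE_of_deltaStep k hfl hvanish h).trans k hYX)
    obtain ⟨g⟩ := nonempty_iso_of_deltaStep k hfl hvanish h
      (hYX.trans k (eulerLE_of_deltaLE k hfl hvanish hXY))
    exact ⟨f ≪≫ g⟩

end FiniteLength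

end Triangulated

/-- Let `k` be a commutative ring and `T` a skeletally small `k`-linear
triangulated category with split idempotents such that all Hom-spaces `Hom_T(X,Y)` have
finite length over `k`, and such that for all `X, Y` there is `n` with `Hom_T(X,Y[j]) = 0`
for all `j < n`. If `M ⪯_Δ N` and `N ⪯_Δ M` then `M ≅ N`; consequently `⪯_Δ` is a partial
order on the set of isomorphism classes of objects of `T`. -/
theorem stmt_5 (k : Type w) [CommRing k]
    (T : Type u) [Category.{v} T] [Preadditive T] [HasZeroObject T]
    [HasShift T ℤ] [∀ n : ℤ, (shiftFunctor T n).Additive] [Pretriangulated T]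
    [IsTriangulated T] [CategoryTheory.Linear k T] [IsIdempotentComplete T]
    [EssentiallySmall.{v} T]
    (hfl : ∀ X Y : T, IsFiniteLength k (X ⟶ Y))
    (hvanish : ∀ X Y : T, ∃ n : ℤ, ∀ j < n, ∀ f : X ⟶ Y⟦j⟧, f = 0)
    (M N : T) (hMN : deltaLE T M N) (hNM : deltaLE T N M) :
    Nonempty (M ≅ N) := by
  exact nonempty_iso_of_deltaLE k hfl hvanish hMN (eulerLE_of_deltaLE k hfl hvanish hNM)
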